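/- Let K ≥ 1 and Φ(1) ≤ ξ₁ < … < ξ_{K+1} < 1, with secant coefficients u_k = (log Φ⁻¹(ξ_{k+1}) − log Φ⁻¹(ξ_k)) / (ξ_{k+1} − ξ_k) and t_k = (ξ_{k+1} log Φ⁻¹(ξ_k) − ξ_k log Φ⁻¹(ξ_{k+1})) / (ξ_{k+1} − ξ_k) for k = 1, …, K. Let a ≥ 0, Y ∈ ℝ, and let g : E → ℝ be any function on a set E. Then for every x ∈ E and every z ∈ [ξ₁, ξ_{K+1}]: if a · exp( g(x) + u_k · z + t_k ) ≤ Y for all k = 1, …, K, then a · exp( g(x) + log Φ⁻¹(z) ) ≤ Y. In particular, the feasible set of the piecewise-linear approximated constraints is contained in the feasible set of the exact constraint, so the piecewise-linear approximation is conservative for the exact reformulated chance constraint. -/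

import Mathlib

open MeasureTheory ProbabilityTheory

/-- `Φ`, the cumulative distribution function of the standard Gaussian
distribution `N(0,1)` on `ℝ`. -/
noncomputable def stdGaussianCDF (t : ℝ) : ℝ :=
  (ProbabilityTheory.gaussianReal 0 1 (Set.Iic t)).toReal

/-- `Φ⁻¹`, the standard Gaussian quantile function (the inverse of `Φ` on `(0,1)`). -/
noncomputable def stdGaussianQuantile : ℝ → ℝ :=
  Function.invFun stdGaussianCDF

theorem stdGaussianCDF_eq_cdf (t : ℝ) : stdGaussianCDF t = cdf (gaussianReal 0 1) t := by
  rw [cdf_eq_real]; rfl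

theorem hasDerivAt_stdGaussianCDF (t : ℝ) :
    HasDerivAt stdGaussianCDF (gaussianPDFReal 0 1 t) t := by
  have hint : Integrable (gaussianPDFReal 0 1) := integrable_gaussianPDFReal 0 1
  have hcont : Continuous (gaussianPDFReal 0 1) := by
    unfold gaussianPDFReal; fun_prop
  have hΦ (s : ℝ) : stdGaussianCDF s = ∫ x in Set.Iic s, gaussianPDFReal 0 1 x := by
    unfold stdGaussianCDF
    rw [gaussianReal_apply_eq_integral 0 one_ne_zero,
      ENNReal.toReal_ofReal (integral_nonneg fun x => gaussianPDFReal_nonneg 0 1 x)]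
  have heq : stdGaussianCDF =
      fun s => (∫ x in (0 : ℝ)..s, gaussianPDFReal 0 1 x) + stdGaussianCDF 0 := by
    funext s
    rw [hΦ s, hΦ 0, ← intervalIntegral.integral_Iic_sub_Iic hint.integrableOn hint.integrableOn]
    ring
  rw [heq]
  exact (hcont.integral_hasStrictDerivAt 0 t).hasDerivAt.add_const _

theorem stdGaussianCDF_strictMono : StrictMono stdGaussianCDF :=
  strictMono_of_deriv_pos fun t => by
    rw [(hasDerivAt_stdGaussianCDF t).deriv]
    exact gaussianPDFReal_pos 0 1 t one_ne_zero

theorem exists_stdGaussianCDF_eq {z : ℝ} (h1 : stdGaussianCDF 1 ≤ z) (h2 : z < 1) :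
    ∃ t, stdGaussianCDF t = z := by
  have hlim : Filter.Tendsto stdGaussianCDF Filter.atTop (nhds 1) := by
    rw [funext stdGaussianCDF_eq_cdf]
    exact tendsto_cdf_atTop _
  obtain ⟨b, hb⟩ := (hlim.eventually (lt_mem_nhds h2)).exists
  have hc : Continuous stdGaussianCDF :=
    continuous_iff_continuousAt.2 fun t => (hasDerivAt_stdGaussianCDF t).continuousAt
  exact mem_range_of_exists_le_of_exists_ge hc ⟨1, h1⟩ ⟨b, hb.le⟩

theorem stdGaussianCDF_quantile {z : ℝ} (h1 : stdGaussianCDF 1 ≤ z) (h2 : z < 1) :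
    stdGaussianCDF (stdGaussianQuantile z) = z :=
  Function.invFun_eq (exists_stdGaussianCDF_eq h1 h2)

theorem one_le_stdGaussianQuantile {z : ℝ} (h1 : stdGaussianCDF 1 ≤ z) (h2 : z < 1) :
    1 ≤ stdGaussianQuantile z := by
  rwa [← stdGaussianCDF_strictMono.le_iff_le, stdGaussianCDF_quantile h1 h2]

theorem concaveOn_stdGaussianCDF_exp :
    ConcaveOn ℝ (Set.Ici 0) fun s => stdGaussianCDF (Real.exp s) := by
  have hd (s : ℝ) : HasDerivAt (fun s => stdGaussianCDF (Real.exp s))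
      (gaussianPDFReal 0 1 (Real.exp s) * Real.exp s) s :=
    (hasDerivAt_stdGaussianCDF _).comp s (Real.hasDerivAt_exp s)
  refine AntitoneOn.concaveOn_of_deriv (convex_Ici 0)
    (fun s _ => (hd s).continuousAt.continuousWithinAt)
    (fun s _ => (hd s).differentiableAt.differentiableWithinAt) ?_
  intro s hs r _ hsr
  rw [interior_Ici, Set.mem_Ioi] at hs
  rw [(hd s).deriv, (hd r).deriv]
  have hexp : Real.exp r ^ 2 = Real.exp s ^ 2 * Real.exp (2 * (r - s)) := by
    rw [← Real.exp_nat_mul, ← Real.exp_nat_mul, ← Real.exp_add]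
    congr 1
    push_cast
    ring
  have h1 : 1 ≤ Real.exp s ^ 2 := one_le_pow₀ (Real.one_le_exp hs.le)
  have h2 := Real.add_one_le_exp (2 * (r - s))
  simp only [gaussianPDFReal, NNReal.coe_one, sub_zero, mul_one]
  rw [mul_assoc, mul_assoc, ← Real.exp_add, ← Real.exp_add]
  refine mul_le_mul_of_nonneg_left (Real.exp_le_exp.2 ?_) (by positivity)
  nlinarith

theorem convexOn_log_stdGaussianQuantile :
    ConvexOn ℝ (Set.Ico (stdGaussianCDF 1) 1) fun z => Real.log (stdGaussianQuantile z) := by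
  refine ⟨convex_Ico _ _, ?_⟩
  intro x hx y hy a b ha hb hab
  have hz := convex_Ico (stdGaussianCDF 1) 1 hx hy ha hb hab
  have hexp {w : ℝ} (hw : w ∈ Set.Ico (stdGaussianCDF 1) 1) :
      stdGaussianCDF (Real.exp (Real.log (stdGaussianQuantile w))) = w := by
    rw [Real.exp_log (one_pos.trans_le (one_le_stdGaussianQuantile hw.1 hw.2)),
      stdGaussianCDF_quantile hw.1 hw.2]
  have h := concaveOn_stdGaussianCDF_exp.2
    (Real.log_nonneg (one_le_stdGaussianQuantile hx.1 hx.2))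
    (Real.log_nonneg (one_le_stdGaussianQuantile hy.1 hy.2)) ha hb hab
  simp only [hexp hx, hexp hy] at h
  rw [← hexp hz] at h
  exact Real.exp_le_exp.1 (stdGaussianCDF_strictMono.le_iff_le.1 h)

/-- A point between the first and last nodes of a finite sequence lies between two consecutive
nodes. -/
theorem exists_mem_Icc_castSucc_succ {K : ℕ} (hK : 1 ≤ K) (ξ : Fin (K + 1) → ℝ) {z : ℝ}
    (hz : z ∈ Set.Icc (ξ 0) (ξ (Fin.last K))) :
    ∃ k : Fin K, z ∈ Set.Icc (ξ k.castSucc) (ξ k.succ) := by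
  have key (j : Fin (K + 1)) : z ≤ ξ j →
      j = 0 ∨ ∃ k : Fin K, z ∈ Set.Icc (ξ k.castSucc) (ξ k.succ) := by
    induction j using Fin.induction with
    | zero => exact fun _ => Or.inl rfl
    | succ i ih =>
      intro hi
      rcases le_or_gt (ξ i.castSucc) z with h | h
      · exact Or.inr ⟨i, h, hi⟩
      · rcases ih h.le with h0 | h'
        · rw [h0] at h
          exact absurd hz.1 h.not_ge
        · exact Or.inr h'
  refine (key _ hz.2).resolve_left fun h => ?_
  have := congrArg Fin.val h
  simp at this
  omega

theorem stmt_12 {E : Type*} (K : ℕ) (hK : 1 ≤ K) (ξ : Fin (K + 1) → ℝ)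
    (hmono : StrictMono ξ) (hlo : stdGaussianCDF 1 ≤ ξ 0) (hhi : ξ (Fin.last K) < 1)
    (u t : Fin K → ℝ)
    (hu : ∀ k, u k = (Real.log (stdGaussianQuantile (ξ k.succ)) -
        Real.log (stdGaussianQuantile (ξ k.castSucc))) / (ξ k.succ - ξ k.castSucc))
    (ht : ∀ k, t k = (ξ k.succ * Real.log (stdGaussianQuantile (ξ k.castSucc)) -
        ξ k.castSucc * Real.log (stdGaussianQuantile (ξ k.succ))) / (ξ k.succ - ξ k.castSucc))
    (a : ℝ) (ha : 0 ≤ a) (Y : ℝ) (g : E → ℝ) :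
    ∀ x : E, ∀ z ∈ Set.Icc (ξ 0) (ξ (Fin.last K)),
      (∀ k : Fin K, a * Real.exp (g x + u k * z + t k) ≤ Y) →
        a * Real.exp (g x + Real.log (stdGaussianQuantile z)) ≤ Y := by
  intro x z hz h
  obtain ⟨k, hk⟩ := exists_mem_Icc_castSucc_succ hK ξ hz
  refine le_trans ?_ (h k)
  have hmem (j : Fin (K + 1)) : ξ j ∈ Set.Ico (stdGaussianCDF 1) 1 :=
    ⟨hlo.trans (hmono.monotone (Fin.zero_le j)), (hmono.monotone (Fin.le_last j)).trans_lt hhi⟩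
  have hd : 0 < ξ k.succ - ξ k.castSucc := sub_pos.2 (hmono Fin.castSucc_lt_succ)
  have hconv := convexOn_log_stdGaussianQuantile.2 (hmem k.castSucc) (hmem k.succ)
    (div_nonneg (sub_nonneg.2 hk.2) hd.le) (div_nonneg (sub_nonneg.2 hk.1) hd.le)
    (by field_simp; ring)
  have hcomb : ((ξ k.succ - z) / (ξ k.succ - ξ k.castSucc)) • ξ k.castSucc +
      ((z - ξ k.castSucc) / (ξ k.succ - ξ k.castSucc)) • ξ k.succ = z := by
    simp only [smul_eq_mul]
    field_simp
    ring
  simp only [hcomb] at hconv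
  have hsec : Real.log (stdGaussianQuantile z) ≤ u k * z + t k := by
    refine hconv.trans_eq ?_
    rw [hu, ht]
    simp only [smul_eq_mul]
    field_simp
    ring
  rw [add_assoc]
  gcongr
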